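/- Consider the single-robot transect with columns 0, 1, …, t+1 (t ≥ 1) and r ≥ 1 candidate locations per column, loc(j,m) = (j·ω₁, m·ω₂) for m ∈ {1,…,r}; assume every kernel matrix Σ_{XX} formed from finitely many pairwise distinct grid locations is positive definite. Define the Markov value functions by backward recursion: Ṽ_t(u) = max_{1≤m≤r} ½·log(2πe·σ²_{loc(t+1,m)|u}) and, for 0 ≤ i < t, Ṽ_i(u) = max_{1≤m≤r} [ ½·log(2πe·σ²_{loc(i+1,m)|u}) + Ṽ_{i+1}(loc(i+1,m)) ], where u ranges over column-i locations. Define the non-Markovian optimal value functions on histories x_{0:i} = (x_0,…,x_i) with x_j a column-j candidate location: V*_t(x_{0:t}) = max_{1≤m≤r} ½·log(2πe·σ²_{loc(t+1,m)|x_{0:t}}) and, for 0 ≤ i < t, V*_i(x_{0:i}) = max_{1≤m≤r} [ ½·log(2πe·σ²_{loc(i+1,m)|x_{0:i}}) + V*_{i+1}((x_{0:i}, loc(i+1,m))) ]. If ξ < ρ/t and ξ⁴ < (ρ/t − ξ)(ρ − ξ²), then for every i with 0 ≤ i ≤ t and every history x_{0:i}: Ṽ_i(x_i) − ε_i ≤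 V*_i(x_{0:i}) ≤ Ṽ_i(x_i), where ε_i = Σ_{s=i}^{t} Δ(s). -/

import Mathlib

open Real

/-- Squared exponential covariance function on ℝ². -/
noncomputable def seCov (σs σn ℓ₁ ℓ₂ : ℝ) (u v : ℝ × ℝ) : ℝ :=
  σs ^ 2 * Real.exp (-((u.1 - v.1) ^ 2) / (2 * ℓ₁ ^ 2) - (u.2 - v.2) ^ 2 / (2 * ℓ₂ ^ 2)) +
    σn ^ 2 * (if u = v then 1 else 0)

/-- Kernel (covariance) matrix of a finite tuple of locations. -/
noncomputable def kerMat (σs σn ℓ₁ ℓ₂ : ℝ) {ι : Type} [Fintype ι]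
    (x : ι → ℝ × ℝ) : Matrix ι ι ℝ :=
  Matrix.of fun j k => seCov σs σn ℓ₁ ℓ₂ (x j) (x k)

/-- Posterior (conditional) variance σ²_{u|x} = σ(u,u) − Σ_{uX} Σ_{XX}⁻¹ Σ_{Xu}. -/
noncomputable def postVar (σs σn ℓ₁ ℓ₂ : ℝ) (u : ℝ × ℝ) {ι : Type} [Fintype ι] [DecidableEq ι]
    (x : ι → ℝ × ℝ) : ℝ :=
  seCov σs σn ℓ₁ ℓ₂ u u -
    ∑ j, ∑ k, seCov σs σn ℓ₁ ℓ₂ u (x j) * (kerMat σs σn ℓ₁ ℓ₂ x)⁻¹ j k *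
      seCov σs σn ℓ₁ ℓ₂ (x k) u

/-- The per-stage bound Δ(i) on the Gaussian conditional mutual information (Δ(0) = 0). -/
noncomputable def Del (ξ ρ : ℝ) (i : ℕ) : ℝ :=
  if i = 0 then 0
  else (1 / 2) * Real.log (1 - ξ ^ 4 / ((ρ / (i : ℝ) - ξ) * (ρ - ξ ^ 2)))⁻¹

/-- Stagewise Gaussian posterior entropy ½·log(2πe·σ²_{u|x}). -/
noncomputable def ent (σs σn ℓ₁ ℓ₂ : ℝ) (u : ℝ × ℝ) {ι : Type} [Fintype ι] [DecidableEq ι]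
    (x : ι → ℝ × ℝ) : ℝ :=
  (1 / 2) * Real.log (2 * Real.pi * Real.exp 1 * postVar σs σn ℓ₁ ℓ₂ u x)

/-- The candidate location in row `m` of column `j` of the transect grid. -/
noncomputable def loc (ω₁ ω₂ : ℝ) (j m : ℕ) : ℝ × ℝ := ((j : ℝ) * ω₁, (m : ℝ) * ω₂)

/-- The history of sampled locations over columns 0..i induced by the row choices `c`. -/
noncomputable def hist (ω₁ ω₂ : ℝ) {r : ℕ} (c : ℕ → Fin r) (i : ℕ) : Fin (i + 1) → ℝ × ℝ :=
  fun j => loc ω₁ ω₂ (j : ℕ) ((c (j : ℕ) : ℕ) + 1)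

open Matrix

/-- The residual `s - bᵀ K⁻¹ b` is the minimum of the quadratic `s - 2 wᵀ b + wᵀ K w`. -/
theorem schur_isLeast {ι : Type} [Fintype ι] [DecidableEq ι] {K : Matrix ι ι ℝ}
    (hK : K.PosDef) (b : ι → ℝ) (s : ℝ) :
    IsLeast (Set.range fun w : ι → ℝ => s - 2 * (w ⬝ᵥ b) + w ⬝ᵥ (K *ᵥ w))
      (s - b ⬝ᵥ (K⁻¹ *ᵥ b)) := by
  have hdet : IsUnit K.det := hK.det_pos.ne'.isUnit
  have hKT : Kᵀ = K := by simpa [Matrix.IsHermitian] using hK.isHermitian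
  set p := K⁻¹ *ᵥ b with hp
  have hKp : K *ᵥ p = b := by
    rw [hp, Matrix.mulVec_mulVec, Matrix.mul_nonsing_inv _ hdet, Matrix.one_mulVec]
  have hsymm (w : ι → ℝ) : p ⬝ᵥ (K *ᵥ w) = w ⬝ᵥ b := by
    rw [Matrix.dotProduct_mulVec, ← Matrix.mulVec_transpose, hKT, hKp, dotProduct_comm]
  refine ⟨⟨p, ?_⟩, ?_⟩
  · simp only [hKp, dotProduct_comm b p]
    ring
  · rintro _ ⟨w, rfl⟩
    have h := hK.posSemidef.dotProduct_mulVec_nonneg (w - p)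
    simp only [star_trivial, Matrix.mulVec_sub, sub_dotProduct, dotProduct_sub, hKp,
      hsymm] at h
    simp only [dotProduct_comm b p]
    linarith

/-- A Gershgorin-type lower bound for a quadratic form. -/
theorem quadratic_form_lower_bound {ι : Type} [Fintype ι] [DecidableEq ι] (C : ι → ι → ℝ)
    {D e : ℝ} (hdiag : ∀ j, D - e ≤ C j j) (hoff : ∀ j k, j ≠ k → |C j k| ≤ e) (a : ι → ℝ) :
    (D - Fintype.card ι * e) * ∑ j, a j ^ 2 ≤ ∑ j, ∑ k, a j * C j k * a k := by
  have hterm (j k : ι) : (if j = k then D * a j ^ 2 else 0) - e / 2 * a j ^ 2 - e / 2 * a k ^ 2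
      ≤ a j * C j k * a k := by
    split_ifs with hjk
    · subst hjk
      nlinarith [mul_le_mul_of_nonneg_right (hdiag j) (sq_nonneg (a j))]
    · obtain ⟨h₁, h₂⟩ := abs_le.mp (hoff j k hjk)
      nlinarith [mul_nonneg (sub_nonneg.mpr h₂) (sq_nonneg (a j - a k)),
        mul_nonneg (neg_le_iff_add_nonneg.mp h₁) (sq_nonneg (a j + a k))]
  refine le_trans (le_of_eq ?_)
    (Finset.sum_le_sum fun j _ => Finset.sum_le_sum fun k _ => hterm j k)
  simp only [Finset.sum_sub_distrib, Finset.sum_ite_eq, Finset.mem_univ, if_true,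
    Finset.sum_const, Finset.card_univ, nsmul_eq_mul, ← Finset.mul_sum]
  ring

/-- Lower bound for the conditional quadratic after eliminating the last variable. -/
theorem conditional_quadratic_lower_bound {n : ℕ} {K : Matrix (Fin (n + 1)) (Fin (n + 1)) ℝ}
    {b : Fin (n + 1) → ℝ} {D e f : ℝ} (s : ℝ) (hD : 0 < D) (heD : e ≤ D) (hne : n * e < D)
    (hsymm : ∀ j k, K j k = K k j) (hdiag : ∀ j, K j j = D)
    (hoff : ∀ j k, j ≠ k → 0 ≤ K j k ∧ K j k ≤ e)
    (hf : ∀ j : Fin n,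
      |b j.castSucc - b (Fin.last n) * K j.castSucc (Fin.last n) / D| ≤ f)
    (w : Fin (n + 1) → ℝ) :
    s - b (Fin.last n) ^ 2 / D - n * f ^ 2 / (D - n * e) ≤
      s - 2 * (w ⬝ᵥ b) + w ⬝ᵥ (K *ᵥ w) := by
  set a : Fin n → ℝ := fun j => w j.castSucc with ha
  set κ : Fin n → ℝ := fun j => K j.castSucc (Fin.last n) with hκ
  set v : Fin n → ℝ := fun j => b j.castSucc - b (Fin.last n) * κ j / D with hv
  set C : Fin n → Fin n → ℝ := fun j k => K j.castSucc k.castSucc - κ j * κ k / D with hC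
  have hκb (j : Fin n) : 0 ≤ κ j ∧ κ j ≤ e := hoff _ _ (Fin.castSucc_lt_last j).ne
  have hprod (j k : Fin n) : 0 ≤ κ j * κ k / D ∧ κ j * κ k / D ≤ e := by
    refine ⟨div_nonneg (mul_nonneg (hκb j).1 (hκb k).1) hD.le, ?_⟩
    rw [div_le_iff₀ hD]
    exact mul_le_mul (hκb j).2 ((hκb k).2.trans heD) (hκb k).1 ((hκb j).1.trans (hκb j).2)
  have hquad := quadratic_form_lower_bound C (D := D) (e := e)
    (fun j => by simp only [hC, hdiag]; linarith [(hprod j j).2])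
    (fun j k hjk => by
      have h := hoff _ _ (fun h => hjk (Fin.castSucc_injective n h) :
        j.castSucc ≠ k.castSucc)
      rw [abs_le]
      constructor <;> simp only [hC] <;> linarith [(hprod j k).1, (hprod j k).2, h.1, h.2]) a
  rw [Fintype.card_fin] at hquad
  have hL : 0 < D - n * e := sub_pos.mpr hne
  have hlin : -(n * f ^ 2 / (D - n * e)) ≤
      (D - n * e) * ∑ j, a j ^ 2 - 2 * ∑ j, a j * v j := by
    have hterm (j : Fin n) :
        -(f ^ 2 / (D - n * e)) ≤ (D - n * e) * a j ^ 2 - 2 * (a j * v j) := by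
      have hvf : v j ^ 2 ≤ f ^ 2 := sq_le_sq' (abs_le.mp (hf j)).1 (abs_le.mp (hf j)).2
      have h₁ : v j ^ 2 / (D - n * e) ≤ f ^ 2 / (D - n * e) := by gcongr
      have h₂ : (D - n * e) * a j ^ 2 - 2 * (a j * v j) + v j ^ 2 / (D - n * e) =
          ((D - n * e) * a j - v j) ^ 2 / (D - n * e) := by
        field_simp
        ring
      have h₃ : 0 ≤ ((D - n * e) * a j - v j) ^ 2 / (D - n * e) := by positivity
      linarith
    have h := Finset.sum_le_sum fun j (_ : j ∈ Finset.univ) => hterm j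
    simp only [Finset.sum_const, Finset.card_univ, Fintype.card_fin, nsmul_eq_mul,
      Finset.sum_sub_distrib, ← Finset.mul_sum] at h
    linarith [mul_div_assoc (n : ℝ) (f ^ 2) (D - n * e)]
  set y := w (Fin.last n) with hy
  set β := b (Fin.last n) with hβ
  have hwb : w ⬝ᵥ b = ∑ j, a j * v j + β / D * ∑ j, a j * κ j + y * β := by
    rw [dotProduct, Fin.sum_univ_castSucc, Finset.mul_sum, ← Finset.sum_add_distrib]
    congr 1
    refine Finset.sum_congr rfl fun j _ => ?_
    simp only [hv, ha]
    ring
  have hwK : w ⬝ᵥ (K *ᵥ w) = ∑ j, ∑ k, a j * C j k * a k + (∑ j, a j * κ j) ^ 2 / D +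
      2 * y * ∑ j, a j * κ j + D * y ^ 2 := by
    have hlast : ∑ k : Fin n, K (Fin.last n) k.castSucc * w k.castSucc = ∑ j, a j * κ j :=
      Finset.sum_congr rfl fun k _ => by rw [hsymm, mul_comm]
    have hrow (j : Fin n) : a j * ∑ k : Fin n, K j.castSucc k.castSucc * w k.castSucc =
        ∑ k, a j * C j k * a k + a j * κ j * (∑ k, a k * κ k) / D := by
      rw [Finset.mul_sum, Finset.mul_sum, Finset.sum_div, ← Finset.sum_add_distrib]
      refine Finset.sum_congr rfl fun k _ => ?_
      simp only [hC, ha]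
      ring
    simp only [dotProduct, Matrix.mulVec, Fin.sum_univ_castSucc, hlast, hdiag]
    simp only [mul_add, Finset.sum_add_distrib]
    rw [Finset.sum_congr rfl fun j _ => hrow j, Finset.sum_add_distrib, ← Finset.sum_div,
      ← Finset.sum_mul]
    have : ∑ j : Fin n, w j.castSucc * (K j.castSucc (Fin.last n) * w (Fin.last n)) =
        y * ∑ j, a j * κ j := by
      rw [Finset.mul_sum]
      exact Finset.sum_congr rfl fun j _ => by simp only [ha, hκ, hy]; ring
    rw [this]
    ring
  have hsq : 0 ≤ (D * y + ∑ j, a j * κ j - β) ^ 2 / D := by positivity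
  have hexp : (D * y + ∑ j, a j * κ j - β) ^ 2 / D = D * y ^ 2 + (∑ j, a j * κ j) ^ 2 / D +
      β ^ 2 / D + 2 * y * ∑ j, a j * κ j - 2 * (y * β) - 2 * (β / D * ∑ j, a j * κ j) := by
    field_simp
    ring
  rw [hwb, hwK]
  linarith

section Kernel

variable {σs σn ℓ₁ ℓ₂ : ℝ}

theorem seCov_comm (u v : ℝ × ℝ) : seCov σs σn ℓ₁ ℓ₂ u v = seCov σs σn ℓ₁ ℓ₂ v u := by
  simp only [seCov, eq_comm (a := u) (b := v), sub_sq_comm u.1 v.1, sub_sq_comm u.2 v.2]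

theorem seCov_self (u : ℝ × ℝ) : seCov σs σn ℓ₁ ℓ₂ u u = σs ^ 2 + σn ^ 2 := by
  simp [seCov]

theorem seCov_loc_bounds {ω₁ : ℝ} (ω₂ : ℝ) (hω₁ : 0 < ω₁) {j k d : ℕ} (m m' : ℕ)
    (hjk : j ≠ k) (hd : (d : ℝ) ≤ ((j : ℝ) - k) ^ 2) :
    0 ≤ seCov σs σn ℓ₁ ℓ₂ (loc ω₁ ω₂ j m) (loc ω₁ ω₂ k m') ∧
      seCov σs σn ℓ₁ ℓ₂ (loc ω₁ ω₂ j m) (loc ω₁ ω₂ k m') ≤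
        σs ^ 2 * Real.exp (-ω₁ ^ 2 / (2 * ℓ₁ ^ 2)) ^ d := by
  have hne : loc ω₁ ω₂ j m ≠ loc ω₁ ω₂ k m' := by
    intro h
    have h₁ : (j : ℝ) * ω₁ = k * ω₁ := congrArg Prod.fst h
    exact hjk (by exact_mod_cast mul_right_cancel₀ hω₁.ne' h₁)
  simp only [seCov, if_neg hne, mul_zero, add_zero]
  refine ⟨by positivity, ?_⟩
  rw [← Real.exp_nat_mul]
  refine mul_le_mul_of_nonneg_left (Real.exp_le_exp.mpr ?_) (sq_nonneg _)
  simp only [loc]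
  have h₁ : 0 ≤ ((m : ℝ) * ω₂ - m' * ω₂) ^ 2 / (2 * ℓ₂ ^ 2) := by positivity
  have h₂ : (d : ℝ) * (ω₁ ^ 2 / (2 * ℓ₁ ^ 2)) ≤ ((j : ℝ) - k) ^ 2 * (ω₁ ^ 2 / (2 * ℓ₁ ^ 2)) := by
    gcongr
  have h₃ : -((j : ℝ) * ω₁ - k * ω₁) ^ 2 / (2 * ℓ₁ ^ 2) =
      -(((j : ℝ) - k) ^ 2 * (ω₁ ^ 2 / (2 * ℓ₁ ^ 2))) := by ring
  have h₄ : (d : ℝ) * (-ω₁ ^ 2 / (2 * ℓ₁ ^ 2)) = -(d * (ω₁ ^ 2 / (2 * ℓ₁ ^ 2))) := by ring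
  rw [h₃, h₄]
  linarith

theorem postVar_eq_dotProduct (u : ℝ × ℝ) {ι : Type} [Fintype ι] [DecidableEq ι]
    (x : ι → ℝ × ℝ) :
    postVar σs σn ℓ₁ ℓ₂ u x = seCov σs σn ℓ₁ ℓ₂ u u -
      (fun j => seCov σs σn ℓ₁ ℓ₂ u (x j)) ⬝ᵥ
        ((kerMat σs σn ℓ₁ ℓ₂ x)⁻¹ *ᵥ fun j => seCov σs σn ℓ₁ ℓ₂ u (x j)) := by
  simp only [postVar, dotProduct, Matrix.mulVec, Finset.mul_sum, mul_assoc,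
    seCov_comm (x _) u]

theorem postVar_singleton (u v : ℝ × ℝ) :
    postVar σs σn ℓ₁ ℓ₂ u (fun _ : Fin 1 => v) =
      seCov σs σn ℓ₁ ℓ₂ u u - seCov σs σn ℓ₁ ℓ₂ u v ^ 2 / seCov σs σn ℓ₁ ℓ₂ v v := by
  simp [postVar, kerMat, seCov_comm v u]
  ring

/-- Conditioning on more locations does not increase the posterior variance. -/
theorem postVar_le_postVar_singleton {ι : Type} [Fintype ι] [DecidableEq ι] (u : ℝ × ℝ)
    {x : ι → ℝ × ℝ} (hK : (kerMat σs σn ℓ₁ ℓ₂ x).PosDef) (l : ι) :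
    postVar σs σn ℓ₁ ℓ₂ u x ≤ postVar σs σn ℓ₁ ℓ₂ u (fun _ : Fin 1 => x l) := by
  rw [postVar_eq_dotProduct, postVar_singleton]
  have hpos : 0 < seCov σs σn ℓ₁ ℓ₂ (x l) (x l) := hK.diag_pos
  refine ((schur_isLeast hK _ _).2
    ⟨Pi.single l (seCov σs σn ℓ₁ ℓ₂ u (x l) / seCov σs σn ℓ₁ ℓ₂ (x l) (x l)), rfl⟩).trans_eq ?_
  simp only [single_dotProduct, Matrix.mulVec_single, kerMat, Matrix.of_apply, Pi.smul_apply,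
    Matrix.col_apply, MulOpposite.smul_eq_mul_unop, MulOpposite.unop_op]
  field_simp
  ring

end Kernel

/-- The loss of posterior variance caused by truncating the history to its last location. -/
theorem postVar_hist_lower_bound {σs σn ℓ₁ ℓ₂ ω₁ ω₂ ξ ρ : ℝ} (hσs : 0 < σs)
    (hω₁ : 0 < ω₁) (hξ : ξ = Real.exp (-ω₁ ^ 2 / (2 * ℓ₁ ^ 2))) (hξ1 : ξ ≤ 1)
    (hρ : ρ = 1 + σn ^ 2 / σs ^ 2) {r i : ℕ} (c : ℕ → Fin r) (m : ℕ) (hi : i * ξ < ρ)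
    (hK : (kerMat σs σn ℓ₁ ℓ₂ (hist ω₁ ω₂ c i)).PosDef) :
    postVar σs σn ℓ₁ ℓ₂ (loc ω₁ ω₂ (i + 1) m)
        (fun _ : Fin 1 => loc ω₁ ω₂ i ((c i : ℕ) + 1)) -
      σs ^ 2 * (i * ξ ^ 4 / (ρ - i * ξ)) ≤
      postVar σs σn ℓ₁ ℓ₂ (loc ω₁ ω₂ (i + 1) m) (hist ω₁ ω₂ c i) := by
  have hξ0 : 0 < ξ := hξ ▸ Real.exp_pos _
  have hρ1 : 1 ≤ ρ := by rw [hρ]; linarith [div_nonneg (sq_nonneg σn) (sq_nonneg σs)]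
  have hS : 0 < σs ^ 2 := by positivity
  have hDρ : σs ^ 2 + σn ^ 2 = σs ^ 2 * ρ := by rw [hρ]; field_simp
  set u := loc ω₁ ω₂ (i + 1) m with hu
  rw [postVar_eq_dotProduct u (hist ω₁ ω₂ c i), postVar_singleton, seCov_self (loc ω₁ ω₂ i _)]
  obtain ⟨w, hw⟩ := (schur_isLeast hK (fun j => seCov σs σn ℓ₁ ℓ₂ u (hist ω₁ ω₂ c i j))
    (seCov σs σn ℓ₁ ℓ₂ u u)).1
  rw [← hw]
  have hoff (j k : Fin (i + 1)) (hjk : j ≠ k) :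
      0 ≤ kerMat σs σn ℓ₁ ℓ₂ (hist ω₁ ω₂ c i) j k ∧
        kerMat σs σn ℓ₁ ℓ₂ (hist ω₁ ω₂ c i) j k ≤ σs ^ 2 * ξ := by
    have hjk' : (j : ℕ) ≠ k := fun h => hjk (Fin.ext h)
    have h := seCov_loc_bounds (σs := σs) (σn := σn) (ℓ₁ := ℓ₁) (ℓ₂ := ℓ₂) ω₂ hω₁
      (d := 1) ((c j : ℕ) + 1) ((c k : ℕ) + 1) hjk' (by
        have : (1 : ℤ) ≤ (((j : ℕ) : ℤ) - (k : ℕ)) ^ 2 :=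
          Int.add_one_le_iff.mpr (sq_pos_of_ne_zero (by omega))
        exact_mod_cast this)
    rwa [pow_one, ← hξ] at h
  have hul : 0 ≤ seCov σs σn ℓ₁ ℓ₂ u (hist ω₁ ω₂ c i (Fin.last i)) ∧
      seCov σs σn ℓ₁ ℓ₂ u (hist ω₁ ω₂ c i (Fin.last i)) ≤ σs ^ 2 * ξ := by
    have h := seCov_loc_bounds (σs := σs) (σn := σn) (ℓ₁ := ℓ₁) (ℓ₂ := ℓ₂) ω₂ hω₁
      (d := 1) m ((c i : ℕ) + 1) i.succ_ne_self (by push_cast; ring_nf; rfl)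
    rwa [pow_one, ← hξ] at h
  have hf (j : Fin i) : |seCov σs σn ℓ₁ ℓ₂ u (hist ω₁ ω₂ c i j.castSucc) -
      seCov σs σn ℓ₁ ℓ₂ u (hist ω₁ ω₂ c i (Fin.last i)) *
        kerMat σs σn ℓ₁ ℓ₂ (hist ω₁ ω₂ c i) j.castSucc (Fin.last i) / (σs ^ 2 * ρ)| ≤
      σs ^ 2 * ξ ^ 2 := by
    have hb := seCov_loc_bounds (σs := σs) (σn := σn) (ℓ₁ := ℓ₁) (ℓ₂ := ℓ₂) ω₂ hω₁
      (j := i + 1) (k := j) (d := 2) m ((c j : ℕ) + 1) (by omega) (by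
        have : (j : ℝ) + 1 ≤ i := by exact_mod_cast j.isLt
        push_cast
        nlinarith)
    rw [← hξ] at hb
    have hκ := hoff j.castSucc (Fin.last i) (Fin.castSucc_lt_last j).ne
    have hq0 := div_nonneg (mul_nonneg hul.1 hκ.1) (mul_pos hS (one_pos.trans_le hρ1)).le
    have hq1 : seCov σs σn ℓ₁ ℓ₂ u (hist ω₁ ω₂ c i (Fin.last i)) *
        kerMat σs σn ℓ₁ ℓ₂ (hist ω₁ ω₂ c i) j.castSucc (Fin.last i) / (σs ^ 2 * ρ) ≤
        σs ^ 2 * ξ ^ 2 := by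
      rw [div_le_iff₀ (by positivity)]
      calc _ ≤ (σs ^ 2 * ξ) * (σs ^ 2 * ξ) := mul_le_mul hul.2 hκ.2 hκ.1 (by positivity)
        _ = σs ^ 2 * ξ ^ 2 * (σs ^ 2 * 1) := by ring
        _ ≤ _ := by gcongr
    have hb1 : 0 ≤ seCov σs σn ℓ₁ ℓ₂ u (hist ω₁ ω₂ c i j.castSucc) := hb.1
    have hb2 : seCov σs σn ℓ₁ ℓ₂ u (hist ω₁ ω₂ c i j.castSucc) ≤ σs ^ 2 * ξ ^ 2 := hb.2
    rw [abs_le]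
    constructor <;> linarith
  have h := conditional_quadratic_lower_bound (D := σs ^ 2 * ρ) (e := σs ^ 2 * ξ)
    (b := fun j => seCov σs σn ℓ₁ ℓ₂ u (hist ω₁ ω₂ c i j)) (seCov σs σn ℓ₁ ℓ₂ u u)
    (by positivity) (by gcongr; linarith) (by nlinarith) (fun j k => seCov_comm _ _)
    (fun j => (seCov_self _).trans hDρ) hoff hf w
  refine le_trans (le_of_eq ?_) h
  have hne : ρ - i * ξ ≠ 0 := (sub_pos.mpr hi).ne'
  have hrw : (i : ℝ) * (σs ^ 2 * ξ ^ 2) ^ 2 / (σs ^ 2 * ρ - i * (σs ^ 2 * ξ)) =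
      σs ^ 2 * (i * ξ ^ 4 / (ρ - i * ξ)) := by
    rw [show σs ^ 2 * ρ - i * (σs ^ 2 * ξ) = σs ^ 2 * (ρ - i * ξ) by ring]
    field_simp
  rw [hrw, ← hDρ]
  rfl

theorem le_postVar_adjacent {σs σn ℓ₁ ℓ₂ ω₁ ξ ρ : ℝ} (ω₂ : ℝ) (hσs : 0 < σs)
    (hω₁ : 0 < ω₁) (hξ : ξ = Real.exp (-ω₁ ^ 2 / (2 * ℓ₁ ^ 2)))
    (hρ : ρ = 1 + σn ^ 2 / σs ^ 2) (i m m' : ℕ) :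
    σs ^ 2 * (ρ - ξ ^ 2) ≤
      postVar σs σn ℓ₁ ℓ₂ (loc ω₁ ω₂ (i + 1) m) (fun _ : Fin 1 => loc ω₁ ω₂ i m') := by
  have hξ0 : 0 < ξ := hξ ▸ Real.exp_pos _
  have hρ1 : 1 ≤ ρ := by rw [hρ]; linarith [div_nonneg (sq_nonneg σn) (sq_nonneg σs)]
  have hDρ : σs ^ 2 + σn ^ 2 = σs ^ 2 * ρ := by rw [hρ]; field_simp
  have h := seCov_loc_bounds (σs := σs) (σn := σn) (ℓ₁ := ℓ₁) (ℓ₂ := ℓ₂) ω₂ hω₁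
    (d := 1) m m' i.succ_ne_self (by push_cast; ring_nf; rfl)
  rw [pow_one, ← hξ] at h
  rw [postVar_singleton, seCov_self, seCov_self, hDρ, mul_sub]
  refine sub_le_sub_left ?_ _
  rw [div_le_iff₀ (by positivity)]
  calc _ ≤ (σs ^ 2 * ξ) ^ 2 := pow_le_pow_left₀ h.1 h.2 2
    _ = σs ^ 2 * ξ ^ 2 * (σs ^ 2 * 1) := by ring
    _ ≤ _ := by gcongr

theorem Del_eq (ξ ρ : ℝ) (i : ℕ) :
    Del ξ ρ i = -(1 / 2 * Real.log (1 - i * ξ ^ 4 / ((ρ - i * ξ) * (ρ - ξ ^ 2)))) := by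
  unfold Del
  split_ifs with h
  · simp [h]
  · have hi : (i : ℝ) ≠ 0 := by exact_mod_cast h
    have hq : ξ ^ 4 / ((ρ / (i : ℝ) - ξ) * (ρ - ξ ^ 2)) =
        i * ξ ^ 4 / ((ρ - i * ξ) * (ρ - ξ ^ 2)) := by
      rw [show ρ / (i : ℝ) - ξ = (ρ - i * ξ) / i by field_simp,
        div_mul_eq_mul_div, div_div_eq_mul_div, mul_comm (ξ ^ 4)]
    rw [Real.log_inv, hq, mul_neg]

theorem hist_injective {ω₁ : ℝ} (ω₂ : ℝ) (hω₁ : 0 < ω₁) {r : ℕ} (c : ℕ → Fin r) (i : ℕ) :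
    Function.Injective (hist ω₁ ω₂ c i) := by
  intro j k h
  have h₁ : ((j : ℕ) : ℝ) * ω₁ = (k : ℕ) * ω₁ := congrArg Prod.fst h
  exact Fin.ext (by exact_mod_cast mul_right_cancel₀ hω₁.ne' h₁)

/-- The entropy given the whole history differs from the Markov entropy by at most `Δ(i)`. -/
theorem ent_hist_bounds {σs σn ℓ₁ ℓ₂ ω₁ ω₂ ξ ρ : ℝ} (hσs : 0 < σs)
    (hω₁ : 0 < ω₁) (hξ : ξ = Real.exp (-ω₁ ^ 2 / (2 * ℓ₁ ^ 2)))
    (hρ : ρ = 1 + σn ^ 2 / σs ^ 2) {r i : ℕ} (c : ℕ → Fin r) (m : ℕ) (hi : i * ξ < ρ)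
    (hξρ : ξ ^ 2 < ρ) (hi4 : i * ξ ^ 4 < (ρ - i * ξ) * (ρ - ξ ^ 2))
    (hK : (kerMat σs σn ℓ₁ ℓ₂ (hist ω₁ ω₂ c i)).PosDef) :
    ent σs σn ℓ₁ ℓ₂ (loc ω₁ ω₂ (i + 1) m) (fun _ : Fin 1 => loc ω₁ ω₂ i ((c i : ℕ) + 1)) -
        Del ξ ρ i ≤ ent σs σn ℓ₁ ℓ₂ (loc ω₁ ω₂ (i + 1) m) (hist ω₁ ω₂ c i) ∧
      ent σs σn ℓ₁ ℓ₂ (loc ω₁ ω₂ (i + 1) m) (hist ω₁ ω₂ c i) ≤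
        ent σs σn ℓ₁ ℓ₂ (loc ω₁ ω₂ (i + 1) m)
          (fun _ : Fin 1 => loc ω₁ ω₂ i ((c i : ℕ) + 1)) := by
  have hξ1 : ξ ≤ 1 := by
    rw [hξ, Real.exp_le_one_iff, neg_div]
    exact neg_nonpos.mpr (by positivity)
  have hlow := postVar_hist_lower_bound (ω₂ := ω₂) hσs hω₁ hξ hξ1 hρ c m hi hK
  have hup : _ ≤ postVar σs σn ℓ₁ ℓ₂ (loc ω₁ ω₂ (i + 1) m)
      (fun _ : Fin 1 => loc ω₁ ω₂ i ((c i : ℕ) + 1)) :=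
    postVar_le_postVar_singleton (loc ω₁ ω₂ (i + 1) m) hK (Fin.last i)
  have hadj := le_postVar_adjacent (σn := σn) (ℓ₁ := ℓ₁) (ℓ₂ := ℓ₂) ω₂ hσs hω₁ hξ hρ i m
    ((c i : ℕ) + 1)
  rw [Del_eq]
  unfold ent
  set P := postVar σs σn ℓ₁ ℓ₂ (loc ω₁ ω₂ (i + 1) m) (hist ω₁ ω₂ c i)
  set P₁ := postVar σs σn ℓ₁ ℓ₂ (loc ω₁ ω₂ (i + 1) m)
    (fun _ : Fin 1 => loc ω₁ ω₂ i ((c i : ℕ) + 1))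
  set q := (i : ℝ) * ξ ^ 4 / ((ρ - i * ξ) * (ρ - ξ ^ 2)) with hq
  have ha : 0 < ρ - i * ξ := sub_pos.mpr hi
  have hb : 0 < ρ - ξ ^ 2 := sub_pos.mpr hξρ
  have hq0 : 0 ≤ q := by positivity
  have hq1 : 0 < 1 - q := sub_pos.mpr ((div_lt_one (mul_pos ha hb)).mpr hi4)
  have hP₁ : 0 < P₁ := (by positivity : 0 < σs ^ 2 * (ρ - ξ ^ 2)).trans_le hadj
  have hloss : σs ^ 2 * (i * ξ ^ 4 / (ρ - i * ξ)) ≤ P₁ * q := by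
    refine le_trans (le_of_eq ?_) (mul_le_mul_of_nonneg_right hadj hq0)
    rw [hq]
    field_simp
  have hPq : P₁ * (1 - q) ≤ P := by linarith
  have hP : 0 < P := (mul_pos hP₁ hq1).trans_le hPq
  constructor
  · have h := Real.log_le_log (by positivity) (mul_le_mul_of_nonneg_left hPq
      (by positivity : 0 ≤ 2 * Real.pi * Real.exp 1))
    rw [← mul_assoc, Real.log_mul (by positivity) hq1.ne'] at h
    linarith
  · gcongr

theorem ciSup_fin_close {r : ℕ} [NeZero r] {f g : Fin r → ℝ} {ε : ℝ}
    (hlow : ∀ a, f a - ε ≤ g a) (hup : ∀ a, g a ≤ f a) :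
    (⨆ a, f a) - ε ≤ ⨆ a, g a ∧ ⨆ a, g a ≤ ⨆ a, f a := by
  refine ⟨?_, ciSup_mono (Set.finite_range f).bddAbove hup⟩
  rw [sub_le_iff_le_add]
  refine ciSup_le fun a => ?_
  linarith [hlow a, le_ciSup (Set.finite_range g).bddAbove a]

theorem stmt_7 (σs σn ℓ₁ ℓ₂ ω₁ ω₂ ξ ρ : ℝ)
    (hσs : 0 < σs) (hσn : 0 < σn) (hℓ₁ : 0 < ℓ₁) (hℓ₂ : 0 < ℓ₂)
    (hω₁ : 0 < ω₁) (hω₂ : 0 < ω₂)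
    (hξ : ξ = Real.exp (-ω₁ ^ 2 / (2 * ℓ₁ ^ 2)))
    (hρ : ρ = 1 + σn ^ 2 / σs ^ 2)
    (t r : ℕ) (ht : 1 ≤ t) (hr : 1 ≤ r)
    -- every kernel matrix of finitely many pairwise distinct grid locations is positive definite
    (hPD : ∀ (n : ℕ) (z : Fin n → ℝ × ℝ),
      (∀ p, ∃ a b : ℕ, z p = loc ω₁ ω₂ a b) → Function.Injective z →
        (kerMat σs σn ℓ₁ ℓ₂ z).PosDef)
    (hξρ : ξ < ρ / t) (hξ4 : ξ ^ 4 < (ρ / t - ξ) * (ρ - ξ ^ 2))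
    -- Markov value functions Ṽ_i on column-i candidate locations
    (Vtil : ℕ → ℝ × ℝ → ℝ)
    (hVtilT : ∀ m : Fin r,
      Vtil t (loc ω₁ ω₂ t ((m : ℕ) + 1)) = ⨆ a : Fin r,
        ent σs σn ℓ₁ ℓ₂ (loc ω₁ ω₂ (t + 1) ((a : ℕ) + 1))
          (fun _ : Fin 1 => loc ω₁ ω₂ t ((m : ℕ) + 1)))
    (hVtilI : ∀ i < t, ∀ m : Fin r,
      Vtil i (loc ω₁ ω₂ i ((m : ℕ) + 1)) = ⨆ a : Fin r,
        (ent σs σn ℓ₁ ℓ₂ (loc ω₁ ω₂ (i + 1) ((a : ℕ) + 1))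
            (fun _ : Fin 1 => loc ω₁ ω₂ i ((m : ℕ) + 1)) +
          Vtil (i + 1) (loc ω₁ ω₂ (i + 1) ((a : ℕ) + 1))))
    -- non-Markovian optimal value functions V*_i on histories
    (Vstar : ℕ → (ℕ → Fin r) → ℝ)
    (hVstarT : ∀ c : ℕ → Fin r,
      Vstar t c = ⨆ a : Fin r,
        ent σs σn ℓ₁ ℓ₂ (loc ω₁ ω₂ (t + 1) ((a : ℕ) + 1)) (hist ω₁ ω₂ c t))
    (hVstarI : ∀ i < t, ∀ c : ℕ → Fin r,
      Vstar i c = ⨆ a : Fin r,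
        (ent σs σn ℓ₁ ℓ₂ (loc ω₁ ω₂ (i + 1) ((a : ℕ) + 1)) (hist ω₁ ω₂ c i) +
          Vstar (i + 1) (Function.update c (i + 1) a))) :
    ∀ i ≤ t, ∀ c : ℕ → Fin r,
      Vtil i (loc ω₁ ω₂ i ((c i : ℕ) + 1)) - ∑ s ∈ Finset.Icc i t, Del ξ ρ s ≤ Vstar i c ∧
      Vstar i c ≤ Vtil i (loc ω₁ ω₂ i ((c i : ℕ) + 1)) := by
  have hξ0 : 0 < ξ := hξ ▸ Real.exp_pos _
  have hξ1 : ξ ≤ 1 := by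
    rw [hξ, Real.exp_le_one_iff, neg_div]
    exact neg_nonpos.mpr (by positivity)
  have hρ1 : 1 < ρ := by
    have : 0 < σn ^ 2 / σs ^ 2 := by positivity
    linarith
  have hξρ2 : ξ ^ 2 < ρ := (pow_le_one₀ hξ0.le hξ1).trans_lt hρ1
  have ht0 : (0 : ℝ) < t := by exact_mod_cast ht
  have htξ : t * ξ < ρ := by rwa [lt_div_iff₀ ht0, mul_comm] at hξρ
  have ht4 : t * ξ ^ 4 < (ρ - t * ξ) * (ρ - ξ ^ 2) := by
    have h := mul_lt_mul_of_pos_left hξ4 ht0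
    rwa [← mul_assoc, mul_sub (t : ℝ), mul_div_cancel₀ _ ht0.ne'] at h
  have : NeZero r := ⟨by omega⟩
  have hent (i : ℕ) (hit : i ≤ t) (c : ℕ → Fin r) (m : ℕ) := by
    have hit' : (i : ℝ) ≤ t := by exact_mod_cast hit
    have hiξ : (i : ℝ) * ξ ≤ t * ξ := by gcongr
    have hiξ4 : (i : ℝ) * ξ ^ 4 ≤ t * ξ ^ 4 := by gcongr
    exact ent_hist_bounds hσs hω₁ hξ hρ c m (hiξ.trans_lt htξ) hξρ2
      (hiξ4.trans_lt (ht4.trans_le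
        (mul_le_mul_of_nonneg_right (by linarith) (sub_pos.mpr hξρ2).le)))
      (hPD _ _ (fun p => ⟨p, _, rfl⟩) (hist_injective ω₂ hω₁ c i))
  intro i hit
  induction hit using Nat.decreasingInduction with
  | self =>
    intro c
    rw [hVtilT, hVstarT, Finset.Icc_self, Finset.sum_singleton]
    exact ciSup_fin_close (fun a => (hent t le_rfl c _).1) (fun a => (hent t le_rfl c _).2)
  | of_succ i hi ih =>
    intro c
    rw [hVtilI i hi, hVstarI i hi, ← Finset.insert_Icc_add_one_left_eq_Icc hi.le,
      Finset.sum_insert (by simp)]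
    have hih (a : Fin r) := ih (Function.update c (i + 1) a)
    simp only [Function.update_self] at hih
    refine ciSup_fin_close (fun a => ?_) (fun a => ?_)
    · linarith [(hent i hi.le c ((a : ℕ) + 1)).1, (hih a).1]
    · exact add_le_add (hent i hi.le c _).2 (hih a).2
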